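/- Let n ≥ 1, k ∈ {1,…,n} and s > 1. There is a constant C > 0, depending only on n and s, such that for every ball B = B(x₀, r) ⊂ ℝ^n with r ≥ min(1, |x₀|/2) one has ∫_B (log(e + x_k²))^{-2s} (1 + |x|)^{-1} dx ≤ C |B| (log(e + r))^{-2s}, where x_k denotes the k-th coordinate of x. -/

import Mathlib

open MeasureTheory Metric Real Filter
open scoped ENNReal Topology BigOperators

noncomputable section

/-- `ℝⁿ` with the Euclidean structure. -/
abbrev Eucl (n : ℕ) := EuclideanSpace ℝ (Fin n)

/-- The part of a ball lying in the slab `|x k| < t` is contained in a box. -/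
theorem volume_real_ball_inter_slab_le {n : ℕ} (k : Fin n) (x₀ : Eucl n) {r t : ℝ}
    (hr : 0 < r) (ht : 0 < t) :
    volume.real (ball x₀ r ∩ {x | |x k| < t}) ≤ (2 * r) ^ n * (t / r) := by
  set a : Fin n → ℝ := fun i => if i = k then -t else x₀ i - r with ha
  set b : Fin n → ℝ := fun i => if i = k then t else x₀ i + r with hb
  have hsub : ball x₀ r ∩ {x | |x k| < t} ⊆
      (fun x : Eucl n => x.ofLp) ⁻¹' Set.pi Set.univ (fun i => Set.Ioo (a i) (b i)) := by
    rintro x ⟨hx, hxk⟩ i -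
    have hxk' : -t < x k ∧ x k < t := abs_lt.1 hxk
    by_cases hi : i = k
    · subst hi
      simpa [ha, hb] using hxk'
    · have h1 : |x i - x₀ i| < r := by
        have := PiLp.norm_apply_le (x - x₀) i
        rw [mem_ball, dist_eq_norm] at hx
        simpa using this.trans_lt hx
      have := abs_lt.1 h1
      simp only [ha, hb, hi, if_false, Set.mem_Ioo]
      constructor <;> linarith
  have hprod : ∏ i, (b i - a i) = (2 * r) ^ n * (t / r) := by
    have : ∀ i, b i - a i = (2 * r) * (if i = k then t / r else 1) := by
      intro i
      by_cases hi : i = k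
      · simp only [ha, hb, hi, if_true]; field_simp; ring
      · simp only [ha, hb, hi, if_false]; ring
    simp_rw [this]
    rw [Finset.prod_mul_distrib]
    simp
  have hnn : ∀ i, 0 ≤ b i - a i := by
    intro i
    by_cases hi : i = k
    · simp only [ha, hb, hi, if_true]; linarith
    · simp only [ha, hb, hi, if_false]; linarith
  have hvol : volume (ball x₀ r ∩ {x | |x k| < t}) ≤ ENNReal.ofReal ((2 * r) ^ n * (t / r)) := by
    refine (measure_mono hsub).trans_eq ?_
    rw [(PiLp.volume_preserving_ofLp (Fin n)).measure_preimage
      (MeasurableSet.univ_pi fun i => measurableSet_Ioo).nullMeasurableSet, Real.volume_pi_Ioo,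
      ← hprod, ENNReal.ofReal_prod_of_nonneg fun i _ => hnn i]
  exact ENNReal.toReal_le_of_le_ofReal (by positivity) hvol

/-- Powers of `log (e + r)` are dominated by `√r` away from zero. -/
theorem log_exp_one_add_rpow_le_sqrt {p r : ℝ} (hp : 0 < p) (hr : 1 ≤ r) :
    Real.log (Real.exp 1 + r) ^ p ≤ 2 * (2 * p) ^ p * √r := by
  have he : Real.exp 1 < 3 := Real.exp_one_lt_three
  have he0 := Real.exp_pos 1
  have hlog : 0 ≤ Real.log (Real.exp 1 + r) := Real.log_nonneg (by linarith)
  calc Real.log (Real.exp 1 + r) ^ p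
      ≤ ((Real.exp 1 + r) ^ (1 / (2 * p)) / (1 / (2 * p))) ^ p := by
        gcongr
        exact Real.log_le_rpow_div (by linarith) (by positivity)
    _ = (2 * p) ^ p * √(Real.exp 1 + r) := by
        rw [div_div_eq_mul_div, div_one, Real.mul_rpow (by positivity) (by positivity),
          ← Real.rpow_mul (by linarith), Real.sqrt_eq_rpow, mul_comm]
        congr 2
        field_simp
    _ ≤ (2 * p) ^ p * √(2 ^ 2 * r) := by
        gcongr
        linarith
    _ = 2 * (2 * p) ^ p * √r := by
        rw [Real.sqrt_mul (by norm_num), Real.sqrt_sq (by norm_num)]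
        ring

/-- The weight is bounded by one. -/
theorem log_exp_one_add_rpow_neg_le_one {p y : ℝ} (hp : 0 ≤ p) (hy : 0 ≤ y) :
    Real.log (Real.exp 1 + y) ^ (-p) ≤ 1 := by
  refine Real.rpow_le_one_of_one_le_of_nonpos ?_ (by linarith)
  rw [Real.le_log_iff_exp_le (by positivity)]
  linarith

/-- On a ball `B(x₀,r)` with `r ≥ min(1,|x₀|/2)` one has
`∫_B (log(e+x_k²))^{-2s} (1+|x|)⁻¹ dx ≤ C |B| (log(e+r))^{-2s}` for `s > 1`. -/
theorem integral_log_coord_rpow_neg_two_mul_le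
    (n : ℕ) (hn : 1 ≤ n) (k : Fin n) (s : ℝ) (hs : 1 < s) :
    ∃ C : ℝ, 0 < C ∧
      ∀ (x₀ : Eucl n) (r : ℝ), 0 < r → min 1 (‖x₀‖ / 2) ≤ r →
        ∫ x in ball x₀ r, Real.log (Real.exp 1 + (x k) ^ 2) ^ (-(2 * s)) * (1 + ‖x‖)⁻¹
          ≤ C * (volume (ball x₀ r)).toReal * Real.log (Real.exp 1 + r) ^ (-(2 * s)) := by
  set p := 2 * s with hp
  have hp0 : 0 < p := by linarith
  set v := volume.real (ball (0 : Eucl n) 1) with hv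
  have hv0 : 0 < v := ENNReal.toReal_pos (measure_ball_pos _ _ one_pos).ne' measure_ball_lt_top.ne
  set A := Real.log (Real.exp 1 + 1) ^ p with hA
  set D := 2 ^ n / v * (2 * (2 * p) ^ p) with hD
  have hlogpos : ∀ y : ℝ, 0 ≤ y → 0 < Real.log (Real.exp 1 + y) := fun y hy =>
    Real.log_pos (by linarith [Real.add_one_le_exp (1 : ℝ)])
  have hA0 : 0 < A := Real.rpow_pos_of_pos (hlogpos 1 zero_le_one) _
  have hD0 : 0 < D := by positivity
  refine ⟨A + (1 + D), by positivity, fun x₀ r hr _ => ?_⟩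
  change _ ≤ _ * volume.real (ball x₀ r) * _
  set V := volume.real (ball x₀ r) with hV
  set L := Real.log (Real.exp 1 + r) with hL
  have hL0 : 0 < L := hlogpos r hr.le
  have hLp : 0 < L ^ (-p) := Real.rpow_pos_of_pos hL0 _
  have hV0 : 0 ≤ V := measureReal_nonneg
  have hweight : ∀ x : Eucl n, Real.log (Real.exp 1 + x k ^ 2) ^ (-p) * (1 + ‖x‖)⁻¹ ≤
      Real.log (Real.exp 1 + x k ^ 2) ^ (-p) := fun x =>
    mul_le_of_le_one_right (Real.rpow_nonneg (hlogpos _ (sq_nonneg _)).le _)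
      (inv_le_one_of_one_le₀ (by linarith [norm_nonneg x]))
  have hnonneg : ∀ x : Eucl n, 0 ≤ Real.log (Real.exp 1 + x k ^ 2) ^ (-p) * (1 + ‖x‖)⁻¹ :=
    fun x => mul_nonneg (Real.rpow_nonneg (hlogpos _ (sq_nonneg _)).le _) (by positivity)
  have hfin : volume (ball x₀ r) ≠ ∞ := measure_ball_lt_top.ne
  rcases le_total r 1 with hr1 | hr1
  · have hALp : 1 ≤ A * L ^ (-p) := by
      rw [Real.rpow_neg hL0.le, ← div_eq_mul_inv, one_le_div (by positivity)]
      have : L ≤ Real.log (Real.exp 1 + 1) := Real.log_le_log (by positivity) (by linarith)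
      exact Real.rpow_le_rpow hL0.le this hp0.le
    calc _ ≤ ∫ _ in ball x₀ r, (1 : ℝ) :=
          integral_mono_of_nonneg (.of_forall hnonneg) (integrableOn_const hfin)
            (.of_forall fun x => (hweight x).trans
              (log_exp_one_add_rpow_neg_le_one hp0.le (sq_nonneg _)))
      _ = V * 1 := by simp [hV]
      _ ≤ V * (A * L ^ (-p)) := by gcongr
      _ ≤ V * (A * L ^ (-p)) + (1 + D) * V * L ^ (-p) := le_add_of_nonneg_right (by positivity)
      _ = _ := by ring
  · have hsqrt : 0 < √r := Real.sqrt_pos.2 hr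
    set S : Set (Eucl n) := {x | |x k| < √r} with hS
    have hSm : MeasurableSet S :=
      measurableSet_lt (by fun_prop) measurable_const
    have hpt : ∀ x : Eucl n, Real.log (Real.exp 1 + x k ^ 2) ^ (-p) * (1 + ‖x‖)⁻¹ ≤
        L ^ (-p) + S.indicator (fun _ => (1 : ℝ)) x := by
      intro x
      refine (hweight x).trans ?_
      by_cases hx : x ∈ S
      · rw [Set.indicator_of_mem hx]
        linarith [log_exp_one_add_rpow_neg_le_one hp0.le (sq_nonneg (x k))]
      · rw [Set.indicator_of_notMem hx, add_zero]
        have hx' : √r ≤ |x k| := not_lt.1 hx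
        have hle : r ≤ x k ^ 2 := by
          rw [← sq_abs]
          exact (Real.sqrt_le_left (abs_nonneg _)).1 hx'
        exact Real.rpow_le_rpow_of_nonpos hL0
          (Real.log_le_log (by positivity) (by linarith)) (by linarith)
    have hind : IntegrableOn (S.indicator fun _ => (1 : ℝ)) (ball x₀ r) :=
      (integrableOn_const hfin).indicator hSm
    have hVr : V = r ^ n * v := by
      rw [hV, hv, measureReal_def, Measure.addHaar_ball_of_pos _ _ hr, ENNReal.toReal_mul,
        ENNReal.toReal_ofReal (by positivity), measureReal_def]
      simp
    have hslab : volume.real (ball x₀ r ∩ S) ≤ D * V * L ^ (-p) := by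
      refine (volume_real_ball_inter_slab_le k x₀ hr hsqrt).trans ?_
      have h1 : √r / r ≤ 2 * (2 * p) ^ p * L ^ (-p) := by
        rw [Real.sqrt_div_self', Real.rpow_neg hL0.le, ← div_eq_mul_inv,
          div_le_div_iff₀ hsqrt (by positivity), one_mul]
        exact log_exp_one_add_rpow_le_sqrt hp0 hr1
      calc (2 * r) ^ n * (√r / r) ≤ (2 * r) ^ n * (2 * (2 * p) ^ p * L ^ (-p)) := by gcongr
        _ = D * V * L ^ (-p) := by
          rw [hVr, hD, mul_pow]
          field_simp
    calc _ ≤ ∫ x in ball x₀ r, (L ^ (-p) + S.indicator (fun _ => (1 : ℝ)) x) :=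
          integral_mono_of_nonneg (.of_forall hnonneg)
            ((integrableOn_const hfin).add hind) (.of_forall hpt)
      _ = V * L ^ (-p) + volume.real (ball x₀ r ∩ S) := by
          rw [integral_add (integrableOn_const hfin).integrable hind, setIntegral_indicator hSm]
          simp [hV]
      _ ≤ V * L ^ (-p) + D * V * L ^ (-p) := by gcongr
      _ ≤ V * L ^ (-p) + D * V * L ^ (-p) + A * V * L ^ (-p) :=
          le_add_of_nonneg_right (by positivity)
      _ = _ := by ring
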